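/- arXiv:2105.13159 — 2 statements merged into one kernel-verified Lean document; each statement's English description precedes it below -/
import Mathlib

section
/- For every initial condition x̄ ∈ (ℝ^n)^N, the metric bounded-confidence model ẋ = f^m(x) admits a Krasovsky solution defined on the whole interval [0, +∞) with x(0) = x̄. -/
open MeasureTheory Set Filter
open scoped Pointwise

noncomputable section

/-- The state space of `N` agents with opinions in `ℝ^n`. -/
abbrev St (n N : ℕ) := Fin N → EuclideanSpace ℝ (Fin n)

/-- The Krasovsky multifunction of a vector field `g`:
`K g (x) = ⋂_{δ>0} closure (convexHull (g '' B(x,δ)))`. -/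
def krasovsky {E : Type*} [NormedAddCommGroup E] [NormedSpace ℝ E] (g : E → E) (x : E) :
    Set E :=
  ⋂ δ > (0:ℝ), closure (convexHull ℝ (g '' Metric.ball x δ))

/-- Krasovsky solution of `ẋ = g(x)` on the set `D`: an absolutely continuous curve
(written in integral form) whose a.e. derivative `v` satisfies `v(s) ∈ K g (x(s))`. -/
def IsKrasovskySolutionOn {E : Type*} [NormedAddCommGroup E] [NormedSpace ℝ E]
    [CompleteSpace E] (g : E → E) (x : ℝ → E) (D : Set ℝ) : Prop :=
  ∃ v : ℝ → E, LocallyIntegrableOn v D ∧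
    (∀ t ∈ D, x t = x 0 + ∫ s in Ioc (0:ℝ) t, v s) ∧
    (∀ᵐ s ∂(volume.restrict D), v s ∈ krasovsky g (x s))

/-- The metric bounded-confidence vector field:
`fᵐᵢ(x) = Σ_{j : ‖x_j - x_i‖ < 1} a(‖x_j - x_i‖)(x_j - x_i)`. -/
def fm {n N : ℕ} (a : ℝ → ℝ) (x : St n N) : St n N :=
  fun i => ∑ j ∈ Finset.univ.filter (fun j => ‖x j - x i‖ < 1),
    a ‖x j - x i‖ • (x j - x i)

/-- The `j`-th point of the explicit Euler scheme with step `h` started at `x₀`. -/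
def eulerPoint {E : Type*} [NormedAddCommGroup E] [NormedSpace ℝ E] (g : E → E) (x₀ : E)
    (h : ℝ) (j : ℕ) : E :=
  (fun y => y + h • g y)^[j] x₀

/-- The piecewise constant Euler curve with step `1 / (k + 1)`. -/
def eulerCurve {E : Type*} [NormedAddCommGroup E] [NormedSpace ℝ E] (g : E → E) (x₀ : E)
    (k : ℕ) (t : ℝ) : E :=
  eulerPoint g x₀ ((k : ℝ) + 1)⁻¹ ⌊t * ((k : ℝ) + 1)⌋₊

section Euler

variable {E : Type*} [NormedAddCommGroup E] [NormedSpace ℝ E]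

lemma eulerPoint_sub (g : E → E) (x₀ : E) (h : ℝ) {p q : ℕ} (hpq : p ≤ q) :
    eulerPoint g x₀ h q - eulerPoint g x₀ h p =
      h • ∑ i ∈ Finset.Ico p q, g (eulerPoint g x₀ h i) := by
  induction q, hpq using Nat.le_induction with
  | base => simp
  | succ q hpq ih =>
    have hstep : eulerPoint g x₀ h (q + 1) =
        eulerPoint g x₀ h q + h • g (eulerPoint g x₀ h q) := by
      simp only [eulerPoint, Function.iterate_succ_apply']
    rw [Finset.sum_Ico_succ_top hpq, smul_add, ← ih, hstep]
    abel

lemma norm_eulerPoint_sub_le {g : E → E} {M : ℝ} (hM : ∀ y, ‖g y‖ ≤ M) (x₀ : E) {h : ℝ}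
    (hh : 0 ≤ h) {p q : ℕ} (hpq : p ≤ q) :
    ‖eulerPoint g x₀ h q - eulerPoint g x₀ h p‖ ≤ M * (h * ((q : ℝ) - p)) := by
  rw [eulerPoint_sub g x₀ h hpq, norm_smul, Real.norm_of_nonneg hh]
  calc h * ‖∑ i ∈ Finset.Ico p q, g (eulerPoint g x₀ h i)‖
      ≤ h * ∑ i ∈ Finset.Ico p q, M := by
        gcongr
        exact norm_sum_le_of_le _ fun i _ => hM _
    _ = M * (h * ((q : ℝ) - p)) := by
        rw [Finset.sum_const, Nat.card_Ico, nsmul_eq_mul, Nat.cast_sub hpq]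
        ring

lemma floor_mul_sub_floor_mul_le {s t c : ℝ} (hst : s ≤ t) (hc : 0 < c) :
    c⁻¹ * ((⌊t * c⌋₊ : ℝ) - ⌊s * c⌋₊) ≤ t - s + c⁻¹ := by
  have key : (⌊t * c⌋₊ : ℝ) - ⌊s * c⌋₊ ≤ (t - s) * c + 1 := by
    have h1 := Nat.lt_floor_add_one (s * c)
    rcases le_total 0 (t * c) with h | h
    · have h2 := Nat.floor_le h
      linarith
    · rw [Nat.floor_of_nonpos h]
      have : (0 : ℝ) ≤ ⌊s * c⌋₊ := Nat.cast_nonneg _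
      have : 0 ≤ (t - s) * c := mul_nonneg (sub_nonneg.2 hst) hc.le
      push_cast
      linarith
  calc c⁻¹ * ((⌊t * c⌋₊ : ℝ) - ⌊s * c⌋₊) ≤ c⁻¹ * ((t - s) * c + 1) := by gcongr
    _ = t - s + c⁻¹ := by field_simp

lemma norm_eulerCurve_sub_le {g : E → E} {M : ℝ} (hM : ∀ y, ‖g y‖ ≤ M) (x₀ : E) (k : ℕ)
    {s t : ℝ} (hst : s ≤ t) :
    ‖eulerCurve g x₀ k t - eulerCurve g x₀ k s‖ ≤ M * (t - s + ((k : ℝ) + 1)⁻¹) := by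
  have hM0 : 0 ≤ M := (norm_nonneg _).trans (hM 0)
  have hk : (0 : ℝ) < (k : ℝ) + 1 := by positivity
  have hfl : ⌊s * ((k : ℝ) + 1)⌋₊ ≤ ⌊t * ((k : ℝ) + 1)⌋₊ := by gcongr
  exact (norm_eulerPoint_sub_le hM x₀ (inv_nonneg.2 hk.le) hfl).trans
    (mul_le_mul_of_nonneg_left (floor_mul_sub_floor_mul_le hst hk) hM0)

lemma eulerCurve_zero (g : E → E) (x₀ : E) (k : ℕ) : eulerCurve g x₀ k 0 = x₀ := by
  simp [eulerCurve, eulerPoint]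

lemma tendsto_inv_mul_floor {t : ℝ} (ht : 0 ≤ t) :
    Tendsto (fun k : ℕ => ((k : ℝ) + 1)⁻¹ * (⌊t * ((k : ℝ) + 1)⌋₊ : ℝ)) atTop (nhds t) := by
  have h := (tendsto_nat_floor_mul_div_atTop ht).comp
    (tendsto_atTop_add_const_right _ (1 : ℝ) (tendsto_natCast_atTop_atTop (R := ℝ)))
  refine h.congr fun k => ?_
  simp [div_eq_inv_mul]

lemma inv_smul_sum_mem_convexHull {ι : Type*} {s : Finset ι} (hs : s.Nonempty) {z : ι → E}
    {C : Set E} (hz : ∀ i ∈ s, z i ∈ C) :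
    ((s.card : ℝ)⁻¹ • ∑ i ∈ s, z i) ∈ convexHull ℝ C := by
  rw [Finset.smul_sum]
  have hc : (0 : ℝ) < s.card := Nat.cast_pos.2 hs.card_pos
  refine (convex_convexHull ℝ C).sum_mem (fun _ _ => by positivity) ?_
    fun i hi => subset_convexHull ℝ C (hz i hi)
  rw [Finset.sum_const, nsmul_eq_mul, mul_inv_cancel₀ hc.ne']

/-- Forward difference quotients of a pointwise limit of Euler curves lie in the closed convex
hull of nearby values of the vector field. -/
lemma differenceQuotient_mem_closure_convexHull {g : E → E} {M : ℝ} (hM : ∀ y, ‖g y‖ ≤ M)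
    {x₀ : E} {l : Filter ℕ} [l.NeBot] (hl : l ≤ atTop) {x : ℝ → E}
    (hx : ∀ t, Tendsto (fun k => eulerCurve g x₀ k t) l (nhds (x t)))
    {t h δ : ℝ} (ht : 0 ≤ t) (hh : 0 < h) (hδ : M * h < δ) :
    h⁻¹ • (x (t + h) - x t) ∈ closure (convexHull ℝ (g '' Metric.ball (x t) δ)) := by
  have hM0 : 0 ≤ M := (norm_nonneg _).trans (hM 0)
  have hlen : Tendsto (fun k : ℕ => ((k : ℝ) + 1)⁻¹ *
      ((⌊(t + h) * ((k : ℝ) + 1)⌋₊ : ℝ) - ⌊t * ((k : ℝ) + 1)⌋₊)) l (nhds h) := by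
    have := ((tendsto_inv_mul_floor (add_nonneg ht hh.le)).sub
      (tendsto_inv_mul_floor ht)).mono_left hl
    rw [add_sub_cancel_left] at this
    exact this.congr fun k => (mul_sub _ _ _).symm
  have hquot := (hlen.inv₀ hh.ne').smul ((hx (t + h)).sub (hx t))
  have hdist : Tendsto (fun k => ‖eulerCurve g x₀ k t - x t‖ + M * (((k : ℝ) + 1)⁻¹ *
      ((⌊(t + h) * ((k : ℝ) + 1)⌋₊ : ℝ) - ⌊t * ((k : ℝ) + 1)⌋₊))) l (nhds (0 + M * h)) := by
    refine Tendsto.add ?_ (hlen.const_mul M)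
    simpa using ((hx t).sub_const (x t)).norm
  rw [zero_add] at hdist
  refine mem_closure_of_tendsto hquot ?_
  filter_upwards [hdist.eventually_lt_const hδ, hlen.eventually_const_lt hh] with k hk hpos
  set c : ℝ := ((k : ℝ) + 1)⁻¹
  have hc : 0 < c := by positivity
  set p := ⌊t * ((k : ℝ) + 1)⌋₊
  set q := ⌊(t + h) * ((k : ℝ) + 1)⌋₊
  have hpq : p < q := by
    have : 0 < (q : ℝ) - p := pos_of_mul_pos_right hpos hc.le
    exact_mod_cast sub_pos.1 this
  have hcurve : eulerCurve g x₀ k (t + h) - eulerCurve g x₀ k t =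
      c • ∑ i ∈ Finset.Ico p q, g (eulerPoint g x₀ c i) := eulerPoint_sub g x₀ c hpq.le
  have hcard : ((Finset.Ico p q).card : ℝ) = (q : ℝ) - p := by
    rw [Nat.card_Ico, Nat.cast_sub hpq.le]
  have heq : (c * ((q : ℝ) - p))⁻¹ • (eulerCurve g x₀ k (t + h) - eulerCurve g x₀ k t) =
      ((Finset.Ico p q).card : ℝ)⁻¹ • ∑ i ∈ Finset.Ico p q, g (eulerPoint g x₀ c i) := by
    rw [hcurve, smul_smul, hcard, mul_inv, mul_right_comm, inv_mul_cancel₀ hc.ne', one_mul]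
  rw [heq]
  refine inv_smul_sum_mem_convexHull (Finset.nonempty_Ico.2 hpq) fun i hi => ?_
  obtain ⟨hpi, hiq⟩ := Finset.mem_Ico.1 hi
  refine mem_image_of_mem g (mem_ball_iff_norm.2 ?_)
  have hi' : (i : ℝ) ≤ q := by exact_mod_cast hiq.le
  calc ‖eulerPoint g x₀ c i - x t‖
      ≤ ‖eulerPoint g x₀ c i - eulerPoint g x₀ c p‖ + ‖eulerPoint g x₀ c p - x t‖ :=
        norm_sub_le_norm_sub_add_norm_sub _ _ _
    _ ≤ M * (c * ((q : ℝ) - p)) + ‖eulerPoint g x₀ c p - x t‖ := by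
        gcongr
        refine (norm_eulerPoint_sub_le hM x₀ hc.le hpi).trans ?_
        gcongr
    _ < δ := by rwa [add_comm]

lemma lipschitzWith_of_tendsto_eulerCurve {g : E → E} {M : NNReal} (hM : ∀ y, ‖g y‖ ≤ M)
    {x₀ : E} {l : Filter ℕ} [l.NeBot] (hl : l ≤ atTop) {x : ℝ → E}
    (hx : ∀ t, Tendsto (fun k => eulerCurve g x₀ k t) l (nhds (x t))) :
    LipschitzWith M x := by
  have key : ∀ s t, s ≤ t → dist (x t) (x s) ≤ M * dist t s := by
    intro s t hst
    have hbound : Tendsto (fun k : ℕ => (M : ℝ) * (t - s + ((k : ℝ) + 1)⁻¹)) l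
        (nhds (M * (t - s + 0))) := by
      refine Tendsto.const_mul _ (Tendsto.const_add _ ?_)
      simpa only [one_div] using (tendsto_one_div_add_atTop_nhds_zero_nat (𝕜 := ℝ)).mono_left hl
    rw [dist_eq_norm, Real.dist_eq, abs_of_nonneg (sub_nonneg.2 hst), ← add_zero (t - s)]
    exact le_of_tendsto_of_tendsto' ((hx t).sub (hx s)).norm hbound
      fun k => norm_eulerCurve_sub_le hM x₀ k hst
  refine LipschitzWith.of_dist_le_mul fun t s => ?_
  rcases le_total s t with h | h
  · exact key s t h
  · rw [dist_comm, dist_comm t]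
    exact key t s h

lemma deriv_mem_krasovsky {g : E → E} {M : NNReal} (hM : ∀ y, ‖g y‖ ≤ M)
    {x₀ : E} {l : Filter ℕ} [l.NeBot] (hl : l ≤ atTop) {x : ℝ → E}
    (hx : ∀ t, Tendsto (fun k => eulerCurve g x₀ k t) l (nhds (x t)))
    {t : ℝ} (ht : 0 ≤ t) (hd : DifferentiableAt ℝ x t) : deriv x t ∈ krasovsky g (x t) := by
  refine mem_iInter₂.2 fun δ hδ => ?_
  have hslope := hd.hasDerivAt.tendsto_slope_zero_right
  refine isClosed_closure.mem_of_tendsto hslope ?_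
  have hsmall : Tendsto (fun h : ℝ => (M : ℝ) * h) (nhdsWithin 0 (Ioi 0)) (nhds 0) := by
    have : Tendsto (fun h : ℝ => (M : ℝ) * h) (nhds 0) (nhds (M * 0)) := tendsto_id.const_mul _
    rw [mul_zero] at this
    exact this.mono_left nhdsWithin_le_nhds
  filter_upwards [hsmall.eventually_lt_const hδ, self_mem_nhdsWithin] with h hMh hh
  exact differenceQuotient_mem_closure_convexHull hM hl hx ht hh hMh

lemma LipschitzWith.locallyIntegrable_deriv [CompleteSpace E] {x : ℝ → E} {M : NNReal}
    (hx : LipschitzWith M x) : LocallyIntegrable (deriv x) := by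
  refine (locallyIntegrable_const (M : ℝ)).mono (aestronglyMeasurable_deriv x volume) ?_
  refine Eventually.of_forall fun t => ?_
  rw [Real.norm_of_nonneg M.coe_nonneg]
  exact norm_deriv_le_of_lipschitz hx

/-- Fundamental theorem of calculus for Lipschitz curves in a finite-dimensional space. -/
lemma LipschitzWith.integral_deriv_eq_sub [FiniteDimensional ℝ E] {x : ℝ → E} {M : NNReal}
    (hx : LipschitzWith M x) (s t : ℝ) : ∫ u in s..t, deriv x u = x t - x s := by
  have : CompleteSpace E := FiniteDimensional.complete ℝ E
  have hint : IntervalIntegrable (deriv x) volume s t :=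
    (hx.locallyIntegrable_deriv.integrableOn_isCompact isCompact_uIcc).intervalIntegrable
  refine (SeparatingDual.eq_iff_forall_dual_eq (R := ℝ)).2 fun f => ?_
  rw [← f.intervalIntegral_comp_comm hint, map_sub]
  have hf : LipschitzWith (‖f‖₊ * M) (fun u => f (x u)) := f.lipschitz.comp hx
  rw [← ((hf.lipschitzOnWith (s := uIcc s t)).absolutelyContinuousOnInterval).integral_deriv_eq_sub]
  refine intervalIntegral.integral_congr_ae ?_
  filter_upwards [hx.ae_differentiableAt_real] with u hu _
  exact (f.hasFDerivAt.comp_hasDerivAt u hu.hasDerivAt).deriv.symm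

/-- A globally bounded vector field on a finite-dimensional space has global Krasovsky
solutions. -/
theorem exists_krasovskySolution_of_bounded [FiniteDimensional ℝ E] [CompleteSpace E]
    {g : E → E} {M : NNReal} (hM : ∀ y, ‖g y‖ ≤ M) (x₀ : E) :
    ∃ x : ℝ → E, x 0 = x₀ ∧ IsKrasovskySolutionOn g x (Ici 0) := by
  have : ProperSpace E := FiniteDimensional.proper ℝ E
  have hl : (hyperfilter ℕ : Filter ℕ) ≤ atTop := Nat.hyperfilter_le_atTop
  have hlim : ∀ t, ∃ y, Tendsto (fun k => eulerCurve g x₀ k t) (hyperfilter ℕ) (nhds y) := by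
    intro t
    have hbdd : ∀ k, eulerCurve g x₀ k t ∈ Metric.closedBall x₀ (M * (|t| + 1)) := by
      intro k
      have hk : ((k : ℝ) + 1)⁻¹ ≤ 1 := inv_le_one_of_one_le₀ (by simp)
      rw [mem_closedBall_iff_norm]
      rcases le_total 0 t with h | h
      · have := norm_eulerCurve_sub_le hM x₀ k h
        rw [eulerCurve_zero, sub_zero] at this
        rw [abs_of_nonneg h]
        exact this.trans (by gcongr)
      · have := norm_eulerCurve_sub_le hM x₀ k h
        rw [eulerCurve_zero, norm_sub_rev, zero_sub] at this
        rw [abs_of_nonpos h]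
        exact this.trans (by gcongr)
    obtain ⟨y, -, hy⟩ := (isCompact_closedBall x₀ (M * (|t| + 1))).ultrafilter_le_nhds
      ((hyperfilter ℕ).map fun k => eulerCurve g x₀ k t)
      (le_principal_iff.2 (Filter.mem_map.2 (univ_mem' hbdd)))
    exact ⟨y, hy⟩
  choose x hx using hlim
  have hlip := lipschitzWith_of_tendsto_eulerCurve hM hl hx
  refine ⟨x, ?_, deriv x, hlip.locallyIntegrable_deriv.locallyIntegrableOn _, fun t ht => ?_, ?_⟩
  · refine tendsto_nhds_unique (hx 0) ?_
    simp only [eulerCurve_zero]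
    exact tendsto_const_nhds
  · rw [← intervalIntegral.integral_of_le ht, hlip.integral_deriv_eq_sub, add_sub_cancel]
  · filter_upwards [ae_restrict_of_ae hlip.ae_differentiableAt_real,
      ae_restrict_mem measurableSet_Ici] with t hd ht
    exact deriv_mem_krasovsky hM hl hx ht hd

end Euler

lemma norm_fm_le {n N : ℕ} {a : ℝ → ℝ} (ha_nonneg : ∀ r : ℝ, 0 ≤ r → 0 ≤ a r)
    (ha_mono : MonotoneOn a (Set.Ici 0)) (x : St n N) : ‖fm a x‖ ≤ N * a 1 := by
  have h1 : 0 ≤ a 1 := ha_nonneg 1 zero_le_one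
  refine (pi_norm_le_iff_of_nonneg (by positivity)).2 fun i => ?_
  calc ‖fm a x i‖
      ≤ ∑ j ∈ Finset.univ.filter (fun j => ‖x j - x i‖ < 1), a 1 := by
        refine norm_sum_le_of_le _ fun j hj => ?_
        have hj1 : ‖x j - x i‖ ≤ 1 := (Finset.mem_filter.1 hj).2.le
        have ha0 := ha_nonneg _ (norm_nonneg (x j - x i))
        rw [norm_smul, Real.norm_of_nonneg ha0]
        calc a ‖x j - x i‖ * ‖x j - x i‖ ≤ a ‖x j - x i‖ := mul_le_of_le_one_right ha0 hj1
          _ ≤ a 1 := ha_mono (norm_nonneg _) (mem_Ici.2 zero_le_one) hj1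
    _ ≤ ∑ _j : Fin N, a 1 :=
        Finset.sum_le_sum_of_subset_of_nonneg (Finset.filter_subset _ _) fun _ _ _ => h1
    _ = N * a 1 := by simp

/-- For every initial condition, the metric bounded-confidence model admits a global
Krasovsky solution on `[0, +∞)`. -/
theorem metric_krasovsky_global_existence (n N : ℕ) (hn : 1 ≤ n) (hN : 1 ≤ N)
    (a : ℝ → ℝ)
    (ha_lip : ∃ K : NNReal, LipschitzOnWith K a (Set.Ici 0))
    (ha_nonneg : ∀ r : ℝ, 0 ≤ r → 0 ≤ a r)
    (ha_pos : ∀ r : ℝ, 0 < r → 0 < a r)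
    (ha_mono : MonotoneOn a (Set.Ici 0))
    (xbar : St n N) :
    ∃ x : ℝ → St n N, x 0 = xbar ∧ IsKrasovskySolutionOn (fm a) x (Set.Ici 0) := by
  have h1 : 0 ≤ a 1 := ha_nonneg 1 zero_le_one
  exact exists_krasovskySolution_of_bounded (M := ⟨N * a 1, by positivity⟩)
    (norm_fm_le ha_nonneg ha_mono) xbar
end
end

section
/- For κ = 1 and every initial condition x̄ ∈ (ℝ^n)^N, the topological bounded-confidence model ẋ = f^t(x) admits a Caratheodory solution defined on the whole interval [0, +∞) with x(0) = x̄. -/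
open MeasureTheory Set Filter
open scoped Pointwise

noncomputable section

/-- Caratheodory solution of `ẋ = f(x)` on the set `D`: an absolutely continuous curve
satisfying `x(t) = x(0) + ∫_0^t f(x(s)) ds`. -/
def IsCaratheodorySolutionOn {E : Type*} [NormedAddCommGroup E] [NormedSpace ℝ E]
    [CompleteSpace E] (f : E → E) (x : ℝ → E) (D : Set ℝ) : Prop :=
  LocallyIntegrableOn (fun s => f (x s)) D ∧
    ∀ t ∈ D, x t = x 0 + ∫ s in Ioc (0:ℝ) t, f (x s)

/-- `gamma x i` is the smallest index `j ≠ i` minimizing `‖x j - x i‖`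
(with the junk value `i` in the degenerate case `N = 1`). -/
def gamma {n N : ℕ} (x : St n N) (i : Fin N) : Fin N :=
  if h : (Finset.univ.erase i).Nonempty then
    ((Finset.univ.erase i).filter
      (fun j => ‖x j - x i‖ = (Finset.univ.erase i).inf' h fun j => ‖x j - x i‖)).min'
      (by
        obtain ⟨j, hj, hjd⟩ := Finset.exists_mem_eq_inf' h (fun j => ‖x j - x i‖)
        exact ⟨j, Finset.mem_filter.mpr ⟨hj, hjd.symm⟩⟩)
  else i

/-- The topological bounded-confidence vector field with `κ = 1` neighbour:
`fᵗᵢ(x) = a(‖x_{Γ(i)} - x_i‖)(x_{Γ(i)} - x_i)`. -/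
def ft1 {n N : ℕ} (a : ℝ → ℝ) (x : St n N) : St n N :=
  fun i => a ‖x (gamma x i) - x i‖ • (x (gamma x i) - x i)

/-- `x` solves the integral equation `x t = x₀ + ∫₀ᵗ f (x s) ds` inside `S` on `[0, T)`. -/
def IsSolutionBefore {E : Type*} [NormedAddCommGroup E] [NormedSpace ℝ E]
    (f : E → E) (S : Set E) (x₀ : E) (T : EReal) (x : ℝ → E) : Prop :=
  ∀ t : ℝ, 0 ≤ t → (t : EReal) < T →
    x t ∈ S ∧ IntegrableOn (fun s => f (x s)) (Ioc 0 t) ∧ x t = x₀ + ∫ s in Ioc 0 t, f (x s)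

section Continuation

variable {E : Type*} [NormedAddCommGroup E] [NormedSpace ℝ E] {f : E → E} {S : Set E} {x₀ : E}

theorem IsSolutionBefore.congr {T : EReal} {x y : ℝ → E} (hx : IsSolutionBefore f S x₀ T x)
    (hxy : ∀ t : ℝ, 0 ≤ t → (t : EReal) < T → y t = x t) : IsSolutionBefore f S x₀ T y := by
  intro t ht htT
  obtain ⟨h1, h2, h3⟩ := hx t ht htT
  have hEq : EqOn (fun s => f (x s)) (fun s => f (y s)) (Ioc 0 t) := fun s hs => by
    simp only [hxy s hs.1.le ((EReal.coe_le_coe_iff.2 hs.2).trans_lt htT)]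
  rw [hxy t ht htT]
  exact ⟨h1, h2.congr_fun hEq measurableSet_Ioc,
    by rw [← setIntegral_congr_fun measurableSet_Ioc hEq]; exact h3⟩

/-- A bounded solution on a bounded interval `[0, τ)` has an integrable velocity, and the endpoint
given by the integral equation belongs to the closed set `S`. -/
theorem IsSolutionBefore.endpoint_mem (hS : IsClosed S) {C : ℝ} (hC : ∀ x ∈ S, ‖f x‖ ≤ C)
    {τ : ℝ} (hτ : 0 < τ) {x : ℝ → E} (hx : IsSolutionBefore f S x₀ τ x) :
    IntegrableOn (fun s => f (x s)) (Ioc 0 τ) ∧ x₀ + ∫ s in Ioc 0 τ, f (x s) ∈ S := by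
  obtain ⟨u, -, hu, hlim⟩ := exists_seq_strictMono_tendsto' hτ
  have hsol n := hx (u n) (hu n).1.le (EReal.coe_lt_coe_iff.2 (hu n).2)
  have hint : IntegrableOn (fun s => f (x s)) (Ioc 0 τ) := by
    refine integrableOn_Ioc_of_intervalIntegral_norm_bounded_right (I := C * τ)
      (fun n => (hsol n).2.1) hlim (Eventually.of_forall fun n => ?_)
    have hbound : ∀ s ∈ Ioc 0 (u n), ‖‖f (x s)‖‖ ≤ C := fun s hs => by
      rw [norm_norm]
      exact hC _ (hx s hs.1.le (EReal.coe_lt_coe_iff.2 (hs.2.trans_lt (hu n).2))).1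
    have hC0 : 0 ≤ C := (norm_nonneg _).trans (hC _ (hsol n).1)
    have := norm_setIntegral_le_of_norm_le_const (μ := volume) (by simp) hbound
    refine (le_abs_self _).trans (this.trans ?_)
    rw [Real.volume_real_Ioc_of_le (hu n).1.le, sub_zero]
    exact mul_le_mul_of_nonneg_left (hu n).2.le hC0
  refine ⟨hint, ?_⟩
  have hcont := intervalIntegral.continuousOn_primitive
    ((integrableOn_Icc_iff_integrableOn_Ioc (by simp)).2 hint) τ (right_mem_Icc.2 hτ.le)
  have hlim' : Tendsto u atTop (nhdsWithin τ (Icc 0 τ)) :=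
    tendsto_nhdsWithin_iff.2 ⟨hlim, Eventually.of_forall fun n => ⟨(hu n).1.le, (hu n).2.le⟩⟩
  refine hS.mem_of_tendsto ((hcont.tendsto.comp hlim').const_add x₀)
    (Eventually.of_forall fun n => ?_)
  simp only [Function.comp_apply]
  rw [← (hsol n).2.2]
  exact (hsol n).1

/-- Concatenation of a solution on `[0, τ)` with a solution starting from its endpoint. -/
theorem IsSolutionBefore.append {τ ε : ℝ} (hτ : 0 < τ) {x z : ℝ → E}
    (hx : IsSolutionBefore f S x₀ τ x) (hint : IntegrableOn (fun s => f (x s)) (Ioc 0 τ))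
    (hz : IsSolutionBefore f S (x₀ + ∫ s in Ioc 0 τ, f (x s)) ε z) :
    IsSolutionBefore f S x₀ ((τ + ε : ℝ) : EReal)
      (fun t => if t < τ then x t else z (t - τ)) := by
  set y : ℝ → E := fun t => if t < τ then x t else z (t - τ) with hy
  intro t ht htT
  by_cases htτ : t < τ
  · refine (hx.congr (y := y) fun s _ hs => ?_) t ht (EReal.coe_lt_coe_iff.2 htτ)
    simp [hy, EReal.coe_lt_coe_iff.1 hs]
  have hτt : τ ≤ t := not_lt.1 htτ
  obtain ⟨h1, h2, h3⟩ := hz (t - τ) (sub_nonneg.2 hτt)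
    (EReal.coe_lt_coe_iff.2 (by have := EReal.coe_lt_coe_iff.1 htT; linarith))
  have hyt : y t = z (t - τ) := if_neg htτ
  have hEq₁ : EqOn (fun s => f (x s)) (fun s => f (y s)) (Ioo 0 τ) := fun s hs => by
    simp [hy, hs.2]
  have hEq₂ : EqOn (fun s => f (z (s - τ))) (fun s => f (y s)) (Ioc τ t) := fun s hs => by
    simp [hy, hs.1.le.not_gt]
  have hint₁ : IntegrableOn (fun s => f (y s)) (Ioc 0 τ) :=
    (integrableOn_Ioc_iff_integrableOn_Ioo (by simp)).2
      (((integrableOn_Ioc_iff_integrableOn_Ioo (by simp)).1 hint).congr_fun hEq₁ measurableSet_Ioo)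
  have hval₁ : ∫ s in Ioc 0 τ, f (y s) = ∫ s in Ioc 0 τ, f (x s) := by
    rw [integral_Ioc_eq_integral_Ioo, integral_Ioc_eq_integral_Ioo]
    exact (setIntegral_congr_fun measurableSet_Ioo hEq₁).symm
  have hshift : IntervalIntegrable (fun s => f (z (s - τ))) volume τ t := by
    have hz' := (intervalIntegrable_iff_integrableOn_Ioc_of_le (sub_nonneg.2 hτt)).2 h2
    simpa using hz'.comp_sub_right τ
  have hint₂ : IntegrableOn (fun s => f (y s)) (Ioc τ t) :=
    ((intervalIntegrable_iff_integrableOn_Ioc_of_le hτt).1 hshift).congr_fun hEq₂ measurableSet_Ioc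
  have hval₂ : ∫ s in Ioc τ t, f (y s) = ∫ s in Ioc 0 (t - τ), f (z s) := by
    rw [← setIntegral_congr_fun measurableSet_Ioc hEq₂,
      ← intervalIntegral.integral_of_le hτt, ← intervalIntegral.integral_of_le (sub_nonneg.2 hτt),
      intervalIntegral.integral_comp_sub_right (fun s => f (z s)) τ, sub_self]
  have hunion : Ioc 0 τ ∪ Ioc τ t = Ioc 0 t := Ioc_union_Ioc_eq_Ioc hτ.le hτt
  refine ⟨by rw [hyt]; exact h1, hunion ▸ hint₁.union hint₂, ?_⟩
  rw [hyt, h3, ← hunion, setIntegral_union (Ioc_disjoint_Ioc_of_le le_rfl) measurableSet_Ioc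
    hint₁ hint₂, hval₁, hval₂, add_assoc]

/-- A vector field that is bounded on a closed set and admits local forward solutions within this
set from each of its points admits global forward solutions. -/
theorem exists_isSolutionBefore_top (hS : IsClosed S) {C : ℝ} (hC : ∀ x ∈ S, ‖f x‖ ≤ C)
    (hloc : ∀ x ∈ S, ∃ ε : ℝ, 0 < ε ∧ ∃ z, IsSolutionBefore f S x ε z) (hx₀ : x₀ ∈ S) :
    ∃ x, IsSolutionBefore f S x₀ ⊤ x := by
  let P := {p : EReal × (ℝ → E) // 0 < p.1 ∧ IsSolutionBefore f S x₀ p.1 p.2}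
  let r : P → P → Prop := fun p q =>
    p.1.1 ≤ q.1.1 ∧ ∀ t : ℝ, 0 ≤ t → (t : EReal) < p.1.1 → q.1.2 t = p.1.2 t
  have : Nonempty P := by
    obtain ⟨ε, hε, z, hz⟩ := hloc x₀ hx₀
    exact ⟨⟨(ε, z), EReal.coe_pos.2 hε, hz⟩⟩
  have hchain : ∀ c : Set P, IsChain r c → c.Nonempty → ∃ ub, ∀ p ∈ c, r p ub := by
    intro c hc hne
    classical
    let T : EReal := sSup ((fun p : P => p.1.1) '' c)
    let y : ℝ → E := fun t =>
      if h : ∃ p ∈ c, (t : EReal) < p.1.1 then h.choose.1.2 t else 0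
    have hy : ∀ p ∈ c, ∀ t : ℝ, 0 ≤ t → (t : EReal) < p.1.1 → y t = p.1.2 t := by
      intro p hp t ht htp
      have h : ∃ p ∈ c, (t : EReal) < p.1.1 := ⟨p, hp, htp⟩
      have hyt : y t = h.choose.1.2 t := dif_pos h
      rw [hyt]
      by_cases heq : h.choose = p
      · rw [heq]
      · rcases hc h.choose_spec.1 hp heq with h' | h'
        · exact (h'.2 t ht h.choose_spec.2).symm
        · exact h'.2 t ht htp
    have hle : ∀ p ∈ c, p.1.1 ≤ T := fun p hp => le_sSup ⟨p, hp, rfl⟩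
    refine ⟨⟨(T, y), ?_, ?_⟩, fun p hp => ⟨hle p hp, hy p hp⟩⟩
    · obtain ⟨p, hp⟩ := hne
      exact p.2.1.trans_le (hle p hp)
    · intro t ht htT
      obtain ⟨-, ⟨p, hp, rfl⟩, htp⟩ := lt_sSup_iff.1 htT
      exact (p.2.2.congr (hy p hp)) t ht htp
  obtain ⟨m, hm⟩ := exists_maximal_of_nonempty_chains_bounded hchain
    (fun {p q s} hpq hqs => ⟨hpq.1.trans hqs.1, fun t ht htp =>
      (hqs.2 t ht (htp.trans_le hpq.1)).trans (hpq.2 t ht htp)⟩)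
  obtain ⟨⟨T, x⟩, hT, hx⟩ := m
  simp only at hT hx
  induction T with
  | bot => exact absurd hT (by simp)
  | top => exact ⟨x, hx⟩
  | coe τ =>
    have hτ : 0 < τ := EReal.coe_pos.1 hT
    obtain ⟨hint, hmem⟩ := hx.endpoint_mem hS hC hτ
    obtain ⟨ε, hε, z, hz⟩ := hloc _ hmem
    have hlt : τ < τ + ε := by linarith
    have := (hm ⟨(((τ + ε : ℝ) : EReal), _), EReal.coe_pos.2 (hτ.trans hlt),
      hx.append hτ hint hz⟩ ⟨EReal.coe_le_coe_iff.2 hlt.le, fun t _ ht =>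
        if_pos (EReal.coe_lt_coe_iff.1 ht)⟩).1
    exact absurd (EReal.coe_le_coe_iff.1 this) hlt.not_ge

end Continuation

/-- The velocity `a(‖u‖) u` of an agent attracted by a neighbour at relative position `u`. -/
def pull {V : Type*} [NormedAddCommGroup V] [NormedSpace ℝ V] (a : ℝ → ℝ) (u : V) : V :=
  a ‖u‖ • u

/-- `j` is one of the nearest neighbours of `i` in the configuration `x`. -/
def IsNearest {ι V : Type*} [NormedAddCommGroup V] (x : ι → V) (i j : ι) : Prop :=
  j ≠ i ∧ ∀ k, k ≠ i → ‖x j - x i‖ ≤ ‖x k - x i‖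

section Pull

variable {V : Type*} [NormedAddCommGroup V] [NormedSpace ℝ V] {a : ℝ → ℝ}

@[simp]
theorem pull_zero : pull a (0 : V) = 0 := smul_zero _

theorem norm_pull (ha_nonneg : ∀ r : ℝ, 0 ≤ r → 0 ≤ a r) (u : V) : ‖pull a u‖ = a ‖u‖ * ‖u‖ := by
  rw [pull, norm_smul, Real.norm_of_nonneg (ha_nonneg _ (norm_nonneg u))]

theorem norm_pull_le (ha_nonneg : ∀ r : ℝ, 0 ≤ r → 0 ≤ a r) (ha_mono : MonotoneOn a (Ici 0))
    {u : V} {r : ℝ} (hu : ‖u‖ ≤ r) : ‖pull a u‖ ≤ a r * r := by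
  have hr := (norm_nonneg u).trans hu
  rw [norm_pull ha_nonneg]
  exact mul_le_mul (ha_mono (norm_nonneg u) hr hu) hu (norm_nonneg u) (ha_nonneg r hr)

theorem norm_pull_sub_pull_le {K : NNReal} (ha_lip : LipschitzOnWith K a (Ici 0))
    (ha_nonneg : ∀ r : ℝ, 0 ≤ r → 0 ≤ a r) (ha_mono : MonotoneOn a (Ici 0))
    {u w : V} {r : ℝ} (hu : ‖u‖ ≤ r) (hw : ‖w‖ ≤ r) :
    ‖pull a u - pull a w‖ ≤ (a r + K * r) * ‖u - w‖ := by
  have hr := (norm_nonneg u).trans hu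
  have h : pull a u - pull a w = a ‖u‖ • (u - w) + (a ‖u‖ - a ‖w‖) • w := by
    simp only [pull]; module
  have h1 : ‖a ‖u‖ • (u - w)‖ ≤ a r * ‖u - w‖ := by
    rw [norm_smul, Real.norm_of_nonneg (ha_nonneg _ (norm_nonneg u))]
    exact mul_le_mul_of_nonneg_right (ha_mono (norm_nonneg u) hr hu) (norm_nonneg _)
  have h2 : ‖a ‖u‖ - a ‖w‖‖ ≤ K * ‖u - w‖ :=
    (ha_lip.norm_sub_le (norm_nonneg u) (norm_nonneg w)).trans
      (mul_le_mul_of_nonneg_left (abs_norm_sub_norm_le u w) K.2)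
  have h3 : ‖(a ‖u‖ - a ‖w‖) • w‖ ≤ K * ‖u - w‖ * r := by
    rw [norm_smul]
    exact mul_le_mul h2 hw (norm_nonneg w) (by positivity)
  rw [h]
  exact (norm_add_le _ _).trans (by linarith)

theorem continuous_pull (ha_cont : ContinuousOn a (Ici 0)) :
    Continuous (pull a : V → V) :=
  (ha_cont.comp_continuous continuous_norm fun u => norm_nonneg u).smul continuous_id

end Pull

section Nearest

variable {ι V : Type*} [NormedAddCommGroup V] {x : ι → V} {i j k : ι}

theorem IsNearest.norm_eq (hj : IsNearest x i j) (hk : IsNearest x i k) :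
    ‖x j - x i‖ = ‖x k - x i‖ :=
  le_antisymm (hj.2 k hk.1) (hk.2 j hj.1)

theorem exists_isNearest [Finite ι] [Nontrivial ι] (x : ι → V) (i : ι) :
    ∃ j, IsNearest x i j := by
  obtain ⟨j, hj, hmin⟩ := Set.exists_min_image {k | k ≠ i} (fun k => ‖x k - x i‖)
    (Set.toFinite _) (exists_ne i)
  exact ⟨j, hj, hmin⟩

/-- Every agent can be assigned a nearest neighbour in such a way that, among all its nearest
neighbours, the assigned one moves towards the agent at maximal rate. -/
theorem exists_nearest_selection [InnerProductSpace ℝ V] [Finite ι] [Nontrivial ι] {a : ℝ → ℝ}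
    (ha_nonneg : ∀ r : ℝ, 0 ≤ r → 0 ≤ a r) (ha_mono : MonotoneOn a (Ici 0)) (x : ι → V) :
    ∃ g : ι → ι, ∀ i, IsNearest x i (g i) ∧ ∀ k, IsNearest x i k →
      inner ℝ (x i - x k) (pull a (x (g k) - x k)) ≤
        inner ℝ (x i - x (g i)) (pull a (x (g (g i)) - x (g i))) := by
  classical
  let rate (g : ι → ι) (i k : ι) : ℝ := inner ℝ (x i - x k) (pull a (x (g k) - x k))
  -- A partial selection on `s`: every agent of `s` is paired with its neighbour,
  -- or all its nearest neighbours belong to `s` and it has chosen the best one.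
  let Inv (s : Set ι) (g : ι → ι) : Prop := ∀ i ∈ s, IsNearest x i (g i) ∧
    ((g i ∈ s ∧ g (g i) = i) ∨ ∀ k, IsNearest x i k → k ∈ s ∧ rate g i k ≤ rate g i (g i))
  obtain ⟨s, hs⟩ := (Set.toFinite {s : Set ι | ∃ g, Inv s g}).exists_maximal
    ⟨∅, id, fun i hi => absurd hi (Set.notMem_empty i)⟩
  obtain ⟨⟨g, hg⟩, hmax⟩ := hs
  have hInv_congr : ∀ (s' : Set ι) (g' : ι → ι), s ⊆ s' → (∀ i ∈ s, g' i = g i) →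
      ∀ i ∈ s, IsNearest x i (g' i) ∧ ((g' i ∈ s' ∧ g' (g' i) = i) ∨
        ∀ k, IsNearest x i k → k ∈ s' ∧ rate g' i k ≤ rate g' i (g' i)) := by
    intro s' g' hss' hgg' i hi
    obtain ⟨h1, h2⟩ := hg i hi
    rw [hgg' i hi]
    refine ⟨h1, h2.imp (fun h => ⟨hss' h.1, by rw [hgg' _ h.1]; exact h.2⟩) fun h k hk => ?_⟩
    refine ⟨hss' (h k hk).1, ?_⟩
    have := (h k hk).2
    simp only [rate] at this ⊢
    rw [hgg' k (h k hk).1, hgg' (g i) (h _ h1).1]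
    exact this
  have huniv : ∀ i, i ∈ s := by
    by_contra! hne
    choose m hm using exists_isNearest x
    obtain ⟨i, hi, hmin⟩ := Set.exists_min_image {i | i ∉ s} (fun i => ‖x (m i) - x i‖)
      (Set.toFinite _) hne
    by_cases hA : ∀ k, IsNearest x i k → k ∈ s
    · obtain ⟨j, hj, hjmax⟩ := Set.exists_max_image {k | IsNearest x i k} (rate g i)
        (Set.toFinite _) ⟨m i, hm i⟩
      have hupd : ∀ l ∈ s, Function.update g i j l = g l := fun l hl =>
        Function.update_of_ne (ne_of_mem_of_not_mem hl hi) _ _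
      refine hi (hmax (y := insert i s) ⟨Function.update g i j, ?_⟩ (subset_insert i s)
        (mem_insert i s))
      rintro l (rfl | hl)
      · rw [Function.update_self]
        refine ⟨hj, Or.inr fun k hk => ⟨mem_insert_of_mem _ (hA k hk), ?_⟩⟩
        simp only [rate]
        rw [hupd k (hA k hk), hupd j (hA j hj)]
        exact hjmax k hk
      · exact hInv_congr _ _ (subset_insert i s) hupd l hl
    · push Not at hA
      obtain ⟨k, hk, hks⟩ := hA
      have hki : IsNearest x k i := by
        refine ⟨hk.1.symm, fun l hl => ?_⟩
        rw [norm_sub_rev, hk.norm_eq (hm i)]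
        exact (hmin k hks).trans ((hm k).2 l hl)
      set g' := Function.update (Function.update g i k) k i with hg'
      have hg'k : g' k = i := Function.update_self ..
      have hg'i : g' i = k := by
        rw [hg', Function.update_of_ne hk.1.symm, Function.update_self]
      have hupd : ∀ l ∈ s, g' l = g l := fun l hl => by
        rw [hg', Function.update_of_ne (ne_of_mem_of_not_mem hl hks),
          Function.update_of_ne (ne_of_mem_of_not_mem hl hi)]
      have hsub : s ⊆ insert i (insert k s) :=
        (subset_insert k s).trans (subset_insert i _)
      refine hi (hmax (y := insert i (insert k s)) ⟨g', ?_⟩ hsub (mem_insert i _))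
      rintro l (rfl | rfl | hl)
      · rw [hg'i]
        exact ⟨hk, Or.inl ⟨mem_insert_of_mem _ (mem_insert _ _), hg'k⟩⟩
      · rw [hg'k]
        exact ⟨hki, Or.inl ⟨mem_insert _ _, hg'i⟩⟩
      · exact hInv_congr _ _ hsub hupd l hl
  refine ⟨g, fun i => ⟨(hg i (huniv i)).1, fun k hk => ?_⟩⟩
  obtain ⟨hi, ⟨-, hpair⟩ | h⟩ := hg i (huniv i)
  · have hdist : ‖x i - x (g i)‖ = ‖x i - x k‖ := by
      rw [norm_sub_rev, hi.norm_eq hk, norm_sub_rev]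
    have hval : inner ℝ (x i - x (g i)) (pull a (x i - x (g i))) =
        ‖x i - x k‖ * (a ‖x i - x k‖ * ‖x i - x k‖) := by
      rw [pull, real_inner_smul_right, real_inner_self_eq_norm_mul_norm, hdist]
      ring
    rw [hpair, hval]
    exact (real_inner_le_norm _ _).trans (mul_le_mul_of_nonneg_left
      (norm_pull_le ha_nonneg ha_mono ((hg k (huniv k)).1.2 i hk.1.symm)) (norm_nonneg _))
  · exact (h k hk).2

/-- If `j` approaches `i` at maximal rate among the equidistant neighbours `j`, `k` of `i`, and if
`i` moves towards `j`, then the distance to `j` decreases faster than the distance to `k`. -/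
theorem inner_lt_inner_of_rate_le [InnerProductSpace ℝ V] {a : ℝ → ℝ}
    (ha_pos : ∀ r : ℝ, 0 < r → 0 < a r) {p q v w : V} (hp : p ≠ 0) (hpq : p ≠ q)
    (hnorm : ‖p‖ = ‖q‖) (h : inner ℝ q w ≤ inner ℝ p v) :
    inner ℝ p (pull a (-p) - v) < inner ℝ q (pull a (-p) - w) := by
  have hlt : inner ℝ q p < inner ℝ p p := by
    have h1 : 0 < ‖q - p‖ ^ 2 := by
      have := norm_pos_iff.2 (sub_ne_zero.2 hpq.symm); positivity
    rw [norm_sub_sq_real, ← hnorm] at h1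
    rw [real_inner_self_eq_norm_sq]
    linarith
  have ha := ha_pos ‖p‖ (norm_pos_iff.2 hp)
  simp only [pull, inner_sub_right, real_inner_smul_right, inner_neg_right, norm_neg]
  nlinarith [mul_lt_mul_of_pos_left hlt ha]

end Nearest

theorem isNearest_gamma {n N : ℕ} [Nontrivial (Fin N)] (x : St n N) (i : Fin N) :
    IsNearest x i (gamma x i) := by
  have h : (Finset.univ.erase i).Nonempty := by
    obtain ⟨j, hj⟩ := exists_ne i
    exact ⟨j, Finset.mem_erase.2 ⟨hj, Finset.mem_univ j⟩⟩
  have hmem : gamma x i ∈ (Finset.univ.erase i).filter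
      (fun j => ‖x j - x i‖ = (Finset.univ.erase i).inf' h fun j => ‖x j - x i‖) := by
    rw [gamma, dif_pos h]
    exact Finset.min'_mem _ _
  obtain ⟨h1, h2⟩ := Finset.mem_filter.1 hmem
  refine ⟨(Finset.mem_erase.1 h1).1, fun k hk => ?_⟩
  rw [h2]
  exact Finset.inf'_le _ (Finset.mem_erase.2 ⟨hk, Finset.mem_univ k⟩)

theorem ft1_apply {n N : ℕ} (a : ℝ → ℝ) (x : St n N) (i : Fin N) :
    ft1 a x i = pull a (x (gamma x i) - x i) := rfl

theorem exists_hasDerivAt_of_lipschitzOnWith {E : Type*} [NormedAddCommGroup E] [NormedSpace ℝ E]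
    [CompleteSpace E] {F : E → E} {x : E} {K : NNReal}
    (hF : LipschitzOnWith K F (Metric.closedBall x 1)) :
    ∃ ε : ℝ, 0 < ε ∧ ∃ z : ℝ → E, z 0 = x ∧ ∀ t ∈ Icc 0 ε, HasDerivAt z (F (z t)) t := by
  set L : NNReal := K + ‖F x‖₊ + 1 with hL
  have hL0 : (0 : ℝ) < L := by rw [hL]; push_cast; positivity
  have hbound : ∀ y ∈ Metric.closedBall x ((1 : NNReal) : ℝ), ‖F y‖ ≤ L := by
    intro y hy
    have h1 := hF.norm_sub_le hy (Metric.mem_closedBall_self zero_le_one)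
    have h2 : ‖y - x‖ ≤ 1 := by simpa [dist_eq_norm] using hy
    have h3 := norm_sub_norm_le (F y) (F x)
    have h4 : (K : ℝ) * ‖y - x‖ ≤ K := mul_le_of_le_one_right K.2 h2
    rw [hL]; push_cast; linarith
  set δ : ℝ := (L : ℝ)⁻¹ with hδ
  have hδ0 : 0 < δ := inv_pos.2 hL0
  have hPL : IsPicardLindelof (fun _ => F) (tmin := -δ) (tmax := δ)
      ⟨0, by simp [hδ0.le]⟩ x 1 0 L K :=
    IsPicardLindelof.of_time_independent hbound hF (by simp [hδ, hL0.ne'])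
  obtain ⟨z, hz0, hz⟩ := hPL.exists_eq_forall_mem_Icc_hasDerivWithinAt₀
  refine ⟨δ / 2, half_pos hδ0, z, hz0, fun t ht => ?_⟩
  have h1 : -δ < t := by linarith [ht.1]
  have h2 : t < δ := by linarith [ht.2]
  exact (hz t ⟨h1.le, h2.le⟩).hasDerivAt (Icc_mem_nhds h1 h2)

theorem HasDerivAt.eventually_nhdsGT_lt {h : ℝ → ℝ} {h' t : ℝ} (hd : HasDerivAt h h' t)
    (hpos : 0 < h') : ∀ᶠ s in nhdsWithin t (Ioi t), h t < h s := by
  have hslope := (hasDerivWithinAt_iff_tendsto_slope' (lt_irrefl t)).1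
    (hd.hasDerivWithinAt (s := Ioi t))
  filter_upwards [hslope.eventually (lt_mem_nhds hpos), self_mem_nhdsWithin] with s hs hts
  rw [slope_def_field] at hs
  have := (div_pos_iff_of_pos_right (sub_pos.2 hts)).1 hs
  linarith

section LocalSolution

variable {n N : ℕ} {a : ℝ → ℝ}

open Classical in
/-- The vector field in which every agent `i` follows `g i`, except that the agents which coincide
with their neighbour in the configuration `x` do not move. -/
def followField (a : ℝ → ℝ) (g : Fin N → Fin N) (x y : St n N) : St n N :=
  fun i => if x (g i) = x i then 0 else pull a (y (g i) - y i)

theorem lipschitzOnWith_followField {K : NNReal} (ha_lip : LipschitzOnWith K a (Ici 0))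
    (ha_nonneg : ∀ r : ℝ, 0 ≤ r → 0 ≤ a r) (ha_mono : MonotoneOn a (Ici 0))
    (g : Fin N → Fin N) (x : St n N) :
    ∃ M, LipschitzOnWith M (followField a g x) (Metric.closedBall x 1) := by
  set r : ℝ := 2 * (‖x‖ + 1) with hr
  have hr0 : 0 ≤ r := by positivity
  have har := ha_nonneg r hr0
  set M : ℝ := (a r + K * r) * 2 with hM
  have hM0 : 0 ≤ M := by positivity
  have hrel : ∀ y ∈ Metric.closedBall x 1, ∀ i, ‖y (g i) - y i‖ ≤ r := fun y hy i => by
    have h1 : ‖y‖ ≤ ‖x‖ + 1 := by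
      have h2 : ‖y - x‖ ≤ 1 := by simpa [dist_eq_norm] using hy
      have := norm_sub_norm_le y x
      linarith
    have := norm_sub_le (y (g i)) (y i)
    linarith [norm_le_pi_norm y (g i), norm_le_pi_norm y i]
  refine ⟨M.toNNReal, LipschitzOnWith.of_dist_le_mul fun y hy w hw => ?_⟩
  rw [dist_eq_norm, dist_eq_norm, Real.coe_toNNReal M hM0]
  refine (pi_norm_le_iff_of_nonneg (by positivity)).2 fun i => ?_
  rw [Pi.sub_apply, followField, followField]
  split_ifs
  · rw [sub_zero, norm_zero]; positivity
  · refine (norm_pull_sub_pull_le ha_lip ha_nonneg ha_mono (hrel y hy i) (hrel w hw i)).trans ?_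
    have h1 : ‖y (g i) - y i - (w (g i) - w i)‖ ≤ 2 * ‖y - w‖ := by
      rw [show y (g i) - y i - (w (g i) - w i) = (y - w) (g i) - (y - w) i by
        simp only [Pi.sub_apply]; abel]
      have := norm_sub_le ((y - w) (g i)) ((y - w) i)
      linarith [norm_le_pi_norm (y - w) (g i), norm_le_pi_norm (y - w) i]
    calc _ ≤ (a r + K * r) * (2 * ‖y - w‖) := by gcongr
      _ = _ := by rw [hM]; ring

theorem followField_self (g : Fin N → Fin N) (x : St n N) (i : Fin N) :
    followField a g x x i = pull a (x (g i) - x i) := by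
  rw [followField]
  split_ifs with h
  · rw [h, sub_self, pull_zero]
  · rfl

/-- From every configuration `x`, agents can follow a fixed assignment `g` of neighbours that
remain nearest neighbours during a nontrivial time interval. -/
theorem exists_local_solution_following [Nontrivial (Fin N)]
    (ha_lip : ∃ K : NNReal, LipschitzOnWith K a (Ici 0))
    (ha_nonneg : ∀ r : ℝ, 0 ≤ r → 0 ≤ a r) (ha_pos : ∀ r : ℝ, 0 < r → 0 < a r)
    (ha_mono : MonotoneOn a (Ici 0)) (x : St n N) :
    ∃ ε : ℝ, 0 < ε ∧ ∃ z : ℝ → St n N, ∃ g : Fin N → Fin N, z 0 = x ∧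
      (∀ t ∈ Icc 0 ε, HasDerivAt z (fun i => pull a (z t (g i) - z t i)) t) ∧
      (∀ t ∈ Icc 0 ε, ∀ i, IsNearest (z t) i (g i)) ∧
      ∀ t ∈ Ioc 0 ε, ∀ i, ft1 a (z t) i = pull a (z t (g i) - z t i) := by
  obtain ⟨K, ha_lip⟩ := ha_lip
  obtain ⟨g, hg⟩ := exists_nearest_selection ha_nonneg ha_mono x
  obtain ⟨M, hM⟩ := lipschitzOnWith_followField ha_lip ha_nonneg ha_mono g x
  obtain ⟨ε, hε, z, hz0, hz⟩ := exists_hasDerivAt_of_lipschitzOnWith hM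
  have hzi : ∀ t ∈ Icc 0 ε, ∀ i, HasDerivAt (fun s => z s i) (followField a g x (z t) i) t :=
    fun t ht => hasDerivAt_pi.1 (hz t ht)
  -- agents sharing their position with another one do not move
  have hcoinc : ∀ k l, k ≠ l → x k = x l → x (g k) = x k := fun k l hkl h => by
    have := (hg k).1.2 l hkl.symm
    rw [h, sub_self, norm_zero, ← h] at this
    exact sub_eq_zero.1 (norm_le_zero_iff.1 this)
  have hfrozen : ∀ i, x (g i) = x i → ∀ t ∈ Icc 0 ε, z t i = x i := fun i hi t ht => by
    have hderiv : ∀ s ∈ Icc 0 ε, HasDerivAt (fun s => z s i) 0 s := fun s hs => by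
      have := hzi s hs i
      rwa [followField, if_pos hi] at this
    have := constant_of_has_deriv_right_zero
      (fun s hs => (hderiv s hs).continuousAt.continuousWithinAt)
      (fun s hs => (hderiv s (Ico_subset_Icc_self hs)).hasDerivWithinAt) t ht
    rw [this, hz0]
  have hfrozen₂ : ∀ k l, x k = x l → ∀ t ∈ Icc 0 ε, z t k = z t l := fun k l h t ht => by
    by_cases hkl : k = l
    · rw [hkl]
    · rw [hfrozen k (hcoinc k l hkl h) t ht, hfrozen l (hcoinc l k (Ne.symm hkl) h.symm) t ht, h]
  have hvel : ∀ t ∈ Icc 0 ε, ∀ i, followField a g x (z t) i = pull a (z t (g i) - z t i) := by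
    intro t ht i
    rw [followField]
    split_ifs with h
    · rw [hfrozen₂ _ _ h t ht, sub_self, pull_zero]
    · rfl
  -- the agents not located at the selected neighbour become strictly farther
  have hstrict : ∀ᶠ t in nhdsWithin 0 (Ioi 0), ∀ i k, x (g i) ≠ x i → k ≠ i → x k ≠ x (g i) →
      ‖z t (g i) - z t i‖ < ‖z t k - z t i‖ := by
    refine eventually_all.2 fun i => eventually_all.2 fun k => ?_
    by_cases h : x (g i) ≠ x i ∧ k ≠ i ∧ x k ≠ x (g i)
    swap
    · exact Eventually.of_forall fun t h1 h2 h3 => absurd ⟨h1, h2, h3⟩ h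
    obtain ⟨h1, h2, h3⟩ := h
    have hsq : ∀ l, HasDerivAt (fun t => ‖z t i - z t l‖ ^ 2)
        (2 * inner ℝ (x i - x l) (pull a (x (g i) - x i) - pull a (x (g l) - x l))) 0 := by
      intro l
      have h0 : (0 : ℝ) ∈ Icc 0 ε := left_mem_Icc.2 hε.le
      have := ((hzi 0 h0 i).sub (hzi 0 h0 l)).norm_sq
      rw [hz0, followField_self, followField_self] at this
      simpa only [Pi.sub_apply, hz0] using this
    have hd := (hsq k).sub (hsq (g i))
    have hlt : ∀ᶠ t in nhdsWithin 0 (Ioi 0),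
        0 < ‖z t i - z t k‖ ^ 2 - ‖z t i - z t (g i)‖ ^ 2 := by
      rcases ((hg i).1.2 k h2).lt_or_eq with hlt | heq
      · refine hd.continuousAt.continuousWithinAt.tendsto.eventually (lt_mem_nhds ?_)
        simp only [Pi.sub_apply, hz0]
        rw [sub_pos, norm_sub_rev (x i), norm_sub_rev (x i)]
        gcongr
      · have hk : IsNearest x i k := ⟨h2, fun l hl => heq ▸ (hg i).1.2 l hl⟩
        have hinner := inner_lt_inner_of_rate_le ha_pos (sub_ne_zero.2 (Ne.symm h1))
          (fun h => h3 (sub_right_injective h).symm)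
          (by rw [norm_sub_rev, heq, norm_sub_rev]) ((hg i).2 k hk)
        rw [neg_sub] at hinner
        filter_upwards [hd.eventually_nhdsGT_lt (by linarith)] with t ht
        simp only [Pi.sub_apply, hz0] at ht
        rwa [norm_sub_rev (x i) (x k), ← heq, norm_sub_rev (x i), sub_self] at ht
    filter_upwards [hlt] with t ht _ _ _
    rw [norm_sub_rev, norm_sub_rev (z t k)]
    exact lt_of_pow_lt_pow_left₀ 2 (norm_nonneg _) (sub_pos.1 ht)
  obtain ⟨δ, hδ0, hδ⟩ := (mem_nhdsGT_iff_exists_Ioc_subset).1 hstrict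
  have hsub : Icc 0 (min ε δ) ⊆ Icc 0 ε := Icc_subset_Icc_right (min_le_left _ _)
  have hδ' : ∀ t ∈ Ioc 0 (min ε δ), ∀ i k, x (g i) ≠ x i → k ≠ i → x k ≠ x (g i) →
      ‖z t (g i) - z t i‖ < ‖z t k - z t i‖ :=
    fun t ht => hδ ⟨ht.1, ht.2.trans (min_le_right _ _)⟩
  have hnear : ∀ t ∈ Icc 0 (min ε δ), ∀ i, IsNearest (z t) i (g i) := by
    intro t ht i
    refine ⟨(hg i).1.1, fun k hk => ?_⟩
    rcases ht.1.eq_or_lt with rfl | ht0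
    · rw [hz0]; exact (hg i).1.2 k hk
    by_cases h1 : x (g i) = x i
    · rw [hfrozen₂ _ _ h1 t (hsub ht), sub_self, norm_zero]
      exact norm_nonneg _
    by_cases h2 : x k = x (g i)
    · rw [hfrozen₂ _ _ h2 t (hsub ht)]
    · exact (hδ' t ⟨ht0, ht.2⟩ i k h1 hk h2).le
  refine ⟨min ε δ, lt_min hε hδ0, z, g, hz0, fun t ht => ?_, hnear, fun t ht i => ?_⟩
  · refine (hz t (hsub ht)).congr_deriv (funext fun i => hvel t (hsub ht) i)
  · have ht' := Ioc_subset_Icc_self ht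
    have hγ := isNearest_gamma (z t) i
    rw [ft1_apply]
    by_cases h1 : x (g i) = x i
    · have h0 : z t (g i) - z t i = 0 := sub_eq_zero.2 (hfrozen₂ _ _ h1 t (hsub ht'))
      have := hγ.2 (g i) (hg i).1.1
      rw [h0, norm_zero] at this
      rw [h0, norm_le_zero_iff.1 this]
    · by_contra hne
      have h2 : x (gamma (z t) i) ≠ x (g i) := fun h =>
        hne (by rw [hfrozen₂ _ _ h t (hsub ht')])
      exact (hδ' t ht i _ h1 hγ.1 h2).not_ge (hγ.2 _ (hg i).1.1)

/-- While agents follow their nearest neighbours, each nearest-neighbour distance decreases. -/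
theorem norm_sub_le_of_following (ha_nonneg : ∀ r : ℝ, 0 ≤ r → 0 ≤ a r)
    (ha_mono : MonotoneOn a (Ici 0)) {ε : ℝ} {z : ℝ → St n N} {g : Fin N → Fin N}
    (hz : ∀ t ∈ Icc 0 ε, HasDerivAt z (fun i => pull a (z t (g i) - z t i)) t)
    (hnear : ∀ t ∈ Icc 0 ε, ∀ i, IsNearest (z t) i (g i)) {t : ℝ} (ht : t ∈ Icc 0 ε)
    (i : Fin N) : ‖z t (g i) - z t i‖ ≤ ‖z 0 (g i) - z 0 i‖ := by
  have hsq : ∀ s ∈ Icc 0 ε, HasDerivAt (fun s => ‖z s (g i) - z s i‖ ^ 2)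
      (2 * inner ℝ (z s (g i) - z s i)
        (pull a (z s (g (g i)) - z s (g i)) - pull a (z s (g i) - z s i))) s := fun s hs =>
    ((hasDerivAt_pi.1 (hz s hs) (g i)).sub (hasDerivAt_pi.1 (hz s hs) i)).norm_sq
  have hnonpos : ∀ s ∈ Icc 0 ε, inner ℝ (z s (g i) - z s i)
      (pull a (z s (g (g i)) - z s (g i)) - pull a (z s (g i) - z s i)) ≤ 0 := fun s hs => by
    set u := z s (g i) - z s i with hu
    have hle : ‖z s (g (g i)) - z s (g i)‖ ≤ ‖u‖ := by
      have := (hnear s hs (g i)).2 i (hnear s hs i).1.symm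
      rwa [norm_sub_rev (z s i)] at this
    have h1 := (real_inner_le_norm u (pull a (z s (g (g i)) - z s (g i)))).trans
      (mul_le_mul_of_nonneg_left (norm_pull_le ha_nonneg ha_mono hle) (norm_nonneg u))
    have h2 : inner ℝ u (pull a u) = ‖u‖ * (a ‖u‖ * ‖u‖) := by
      rw [pull, real_inner_smul_right, real_inner_self_eq_norm_mul_norm]; ring
    rw [inner_sub_right]
    linarith
  have hanti : AntitoneOn (fun s => ‖z s (g i) - z s i‖ ^ 2) (Icc 0 ε) := by
    refine antitoneOn_of_hasDerivWithinAt_nonpos (convex_Icc 0 ε)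
      (fun s hs => (hsq s hs).continuousAt.continuousWithinAt)
      (fun s hs => (hsq s (interior_subset hs)).hasDerivWithinAt) fun s hs => ?_
    have := hnonpos s (interior_subset hs)
    linarith
  exact (pow_le_pow_iff_left₀ (norm_nonneg _) (norm_nonneg _) two_ne_zero).1
    (hanti (left_mem_Icc.2 (ht.1.trans ht.2)) ht ht.1)

/-- The configurations in which every agent has another agent within distance `R`. -/
def closeNeighbours (n N : ℕ) (R : ℝ) : Set (St n N) :=
  {x | ∀ i, ∃ j, j ≠ i ∧ ‖x j - x i‖ ≤ R}

theorem isClosed_closeNeighbours (R : ℝ) : IsClosed (closeNeighbours n N R) := by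
  have : closeNeighbours n N R =
      ⋂ i, ⋃ j ∈ {j : Fin N | j ≠ i}, {x : St n N | ‖x j - x i‖ ≤ R} := by
    ext x; simp [closeNeighbours]
  rw [this]
  exact isClosed_iInter fun i => (Set.toFinite _).isClosed_biUnion fun j _ =>
    isClosed_le (by fun_prop) continuous_const

theorem norm_ft1_le_of_mem_closeNeighbours [Nontrivial (Fin N)]
    (ha_nonneg : ∀ r : ℝ, 0 ≤ r → 0 ≤ a r) (ha_mono : MonotoneOn a (Ici 0)) {R : ℝ} (hR : 0 ≤ R)
    {x : St n N} (hx : x ∈ closeNeighbours n N R) : ‖ft1 a x‖ ≤ a R * R := by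
  refine (pi_norm_le_iff_of_nonneg (mul_nonneg (ha_nonneg R hR) hR)).2 fun i => ?_
  obtain ⟨j, hj, hjR⟩ := hx i
  exact norm_pull_le ha_nonneg ha_mono (((isNearest_gamma x i).2 j hj).trans hjR)

theorem exists_local_isSolutionBefore_ft1 [Nontrivial (Fin N)]
    (ha_lip : ∃ K : NNReal, LipschitzOnWith K a (Ici 0))
    (ha_nonneg : ∀ r : ℝ, 0 ≤ r → 0 ≤ a r) (ha_pos : ∀ r : ℝ, 0 < r → 0 < a r)
    (ha_mono : MonotoneOn a (Ici 0)) {R : ℝ} {x : St n N} (hx : x ∈ closeNeighbours n N R) :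
    ∃ ε : ℝ, 0 < ε ∧ ∃ z, IsSolutionBefore (ft1 a) (closeNeighbours n N R) x ε z := by
  obtain ⟨ε, hε, z, g, hz0, hz, hnear, hft⟩ :=
    exists_local_solution_following ha_lip ha_nonneg ha_pos ha_mono x
  obtain ⟨K, ha_lip⟩ := ha_lip
  refine ⟨ε, hε, z, fun t ht htε => ?_⟩
  have htε' : t ≤ ε := (EReal.coe_lt_coe_iff.1 htε).le
  have hsub : Icc 0 t ⊆ Icc 0 ε := Icc_subset_Icc_right htε'
  have hzcont : ContinuousOn z (Icc 0 t) := fun s hs =>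
    (hz s (hsub hs)).continuousAt.continuousWithinAt
  have hvcont : ContinuousOn (fun s i => pull a (z s (g i) - z s i)) (Icc 0 t) :=
    continuousOn_pi.2 fun i => (continuous_pull ha_lip.continuousOn).comp_continuousOn
      ((continuousOn_pi.1 hzcont (g i)).sub (continuousOn_pi.1 hzcont i))
  have hEq : EqOn (fun s i => pull a (z s (g i) - z s i)) (fun s => ft1 a (z s)) (Ioc 0 t) :=
    fun s hs => funext fun i => (hft s ⟨hs.1, hs.2.trans htε'⟩ i).symm
  have hint := hvcont.integrableOn_Icc (μ := volume)
  refine ⟨fun i => ?_, (hint.mono_set Ioc_subset_Icc_self).congr_fun hEq measurableSet_Ioc, ?_⟩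
  · obtain ⟨j, hj, hjR⟩ := hx i
    refine ⟨g i, (hnear t ⟨ht, htε'⟩ i).1, ?_⟩
    refine (norm_sub_le_of_following ha_nonneg ha_mono hz hnear ⟨ht, htε'⟩ i).trans ?_
    have := (hnear 0 (left_mem_Icc.2 hε.le) i).2 j hj
    rw [hz0] at this ⊢
    exact this.trans hjR
  · rw [← setIntegral_congr_fun measurableSet_Ioc hEq, ← intervalIntegral.integral_of_le ht,
      intervalIntegral.integral_eq_sub_of_hasDerivAt_of_le ht hzcont
        (fun s hs => hz s (hsub (Ioo_subset_Icc_self hs)))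
        ((intervalIntegrable_iff_integrableOn_Icc_of_le ht).2 hint), hz0]
    abel

end LocalSolution

/-- For `κ = 1` and every initial condition, the topological bounded-confidence model
admits a global Caratheodory solution on `[0, +∞)`. -/
theorem topological_caratheodory_global_existence_one_neighbour (n N : ℕ)
    (hn : 1 ≤ n) (hN : 2 ≤ N) (a : ℝ → ℝ)
    (ha_lip : ∃ K : NNReal, LipschitzOnWith K a (Set.Ici 0))
    (ha_nonneg : ∀ r : ℝ, 0 ≤ r → 0 ≤ a r)
    (ha_pos : ∀ r : ℝ, 0 < r → 0 < a r)
    (ha_mono : MonotoneOn a (Set.Ici 0))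
    (xbar : St n N) :
    ∃ x : ℝ → St n N, x 0 = xbar ∧ IsCaratheodorySolutionOn (ft1 a) x (Set.Ici 0) := by
  have : Nontrivial (Fin N) := Fin.nontrivial_iff_two_le.2 hN
  have hmem : xbar ∈ closeNeighbours n N (2 * ‖xbar‖) := fun i => by
    obtain ⟨j, hj⟩ := exists_ne i
    refine ⟨j, hj, (norm_sub_le _ _).trans ?_⟩
    linarith [norm_le_pi_norm xbar i, norm_le_pi_norm xbar j]
  obtain ⟨x, hx⟩ := exists_isSolutionBefore_top (isClosed_closeNeighbours _)
    (fun y hy => norm_ft1_le_of_mem_closeNeighbours ha_nonneg ha_mono (by positivity) hy)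
    (fun y hy => exists_local_isSolutionBefore_ft1 ha_lip ha_nonneg ha_pos ha_mono hy) hmem
  have h0 : x 0 = xbar := by simpa using (hx 0 le_rfl (EReal.coe_lt_top 0)).2.2
  refine ⟨x, h0, fun t ht => ?_, fun t ht => ?_⟩
  · refine ⟨Icc 0 (t + 1), ?_, ?_⟩
    · rw [← Ici_inter_Iic]
      exact inter_mem_nhdsWithin _ (Iic_mem_nhds (lt_add_one t))
    · exact (integrableOn_Icc_iff_integrableOn_Ioc (by simp)).2
        (hx (t + 1) (by have : (0 : ℝ) ≤ t := ht; linarith) (EReal.coe_lt_top _)).2.1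
  · rw [h0]
    exact (hx t ht (EReal.coe_lt_top t)).2.2
end
end
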